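/- For every r ∈ (0, 1/16], every injective holomorphic map φ from the open unit disk 𝔻 = {z ∈ ℂ : |z| < 1} into ℂ with φ(0) = 0, and every z ∈ ℂ with |z| ≤ r, one has dist(φ(z), ℂ \ φ(𝔻)) ≥ (1 − 8r) · dist(0, ℂ \ φ(𝔻)). -/

import Mathlib

open Metric

open MeasureTheory in
lemma kb_circle (G : ℂ → ℂ) (hG : DifferentiableOn ℂ G (ball 0 1)) (ρ : ℝ) (h0 : 0 < ρ)
    (h1 : ρ < 1) :
    ENNReal.ofReal (2 * Real.pi) * ‖G 0‖ₑ ≤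
      ∫⁻ θ in Set.Ioo (-Real.pi) Real.pi, ‖G (Complex.polarCoord.symm (ρ, θ))‖ₑ := by
  have hd : DiffContOnCl ℂ G (ball 0 |ρ|) := by
    apply DifferentiableOn.diffContOnCl
    rw [closure_ball _ (by simp [h0.ne'])]
    exact hG.mono (closedBall_subset_ball (by rwa [abs_of_pos h0]))
  have h := hd.circleAverage
  rw [Real.circleAverage_eq_integral_add (-Real.pi)] at h
  rw [intervalIntegral.integral_comp_add_right (fun θ => G (circleMap 0 ρ θ)),
    zero_add, intervalIntegral.integral_of_le (by linarith [Real.pi_pos]),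
    show 2 * Real.pi + -Real.pi = Real.pi by ring, integral_Ioc_eq_integral_Ioo] at h
  have h2 : ∫ θ in Set.Ioo (-Real.pi) Real.pi, G (circleMap 0 ρ θ) = (2 * Real.pi) • G 0 := by
    rw [← h, smul_smul, mul_inv_cancel₀ (by positivity), one_smul]
  have h3 := enorm_integral_le_lintegral_enorm (μ := volume.restrict (Set.Ioo (-Real.pi) Real.pi))
    (fun θ => G (circleMap 0 ρ θ))
  rw [h2, enorm_smul, Real.enorm_of_nonneg (by positivity)] at h3
  refine h3.trans (le_of_eq ?_)
  refine lintegral_congr fun θ => ?_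
  rw [Complex.polarCoord_symm_apply, circleMap_zero, Complex.exp_mul_I]
  simp

open scoped Classical MeasureTheory in
open MeasureTheory in
lemma kb_disc (G : ℂ → ℂ) (hG : DifferentiableOn ℂ G (ball 0 1)) (s : ℝ) (h0 : 0 < s)
    (h1 : s < 1) :
    ENNReal.ofReal (Real.pi * s ^ 2) * ‖G 0‖ₑ ≤ ∫⁻ z in ball 0 s, ‖G z‖ₑ := by
  have hmeas : Measurable ((ball (0:ℂ) s).indicator fun z => ‖G z‖ₑ) := by
    have : Measurable ((ball (0:ℂ) s).indicator G) := by
      have hc : ContinuousOn G (ball 0 s) := hG.continuousOn.mono (ball_subset_ball h1.le)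
      have := (hc.measurable_piecewise (g := fun _ => (0:ℂ)) continuousOn_const
        (measurableSet_ball))
      exact (Set.piecewise_eq_indicator (s := ball (0:ℂ) s) (f := G)) ▸ this
    have h := this.enorm
    convert h using 1
    ext z
    by_cases hz : z ∈ ball (0:ℂ) s <;> simp [hz, Set.indicator]
  rw [← lintegral_indicator measurableSet_ball, ← Complex.lintegral_comp_polarCoord_symm,
    polarCoord_target, Measure.volume_eq_prod, setLIntegral_prod]
  · have hsub : Set.Ioo (0:ℝ) s ⊆ Set.Ioi 0 := fun x hx => hx.1
    refine le_trans ?_ (lintegral_mono_set hsub)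
    have hin : ∀ ρ ∈ Set.Ioo (0:ℝ) s, ENNReal.ofReal ρ * (ENNReal.ofReal (2 * Real.pi) * ‖G 0‖ₑ) ≤
        ∫⁻ θ in Set.Ioo (-Real.pi) Real.pi, ENNReal.ofReal (ρ, θ).1 •
          (ball (0:ℂ) s).indicator (fun z => ‖G z‖ₑ) (Complex.polarCoord.symm (ρ, θ)) := by
      intro ρ hρ
      simp only [smul_eq_mul]
      rw [lintegral_const_mul']
      · gcongr
        refine (kb_circle G hG ρ hρ.1 (hρ.2.trans h1)).trans (le_of_eq ?_)
        refine lintegral_congr fun θ => ?_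
        rw [Set.indicator_of_mem]
        rw [mem_ball_zero_iff, Complex.norm_polarCoord_symm, abs_of_pos hρ.1]
        exact hρ.2
      · simp
    refine le_trans ?_ (setLIntegral_mono' measurableSet_Ioo hin)
    rw [lintegral_mul_const' _ _ (by finiteness), ← mul_assoc]
    gcongr
    have : ∫⁻ ρ in Set.Ioo 0 s, ENNReal.ofReal ρ = ENNReal.ofReal (s ^ 2 / 2) := by
      rw [← ofReal_integral_eq_lintegral_ofReal]
      · rw [← integral_Ioc_eq_integral_Ioo, ← intervalIntegral.integral_of_le h0.le, integral_id]
        simp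
      · exact (continuous_id.integrableOn_Icc (a := 0) (b := s)).mono_set Set.Ioo_subset_Icc_self
      · filter_upwards [ae_restrict_mem measurableSet_Ioo] with x hx using hx.1.le
    rw [this, ← ENNReal.ofReal_mul (by positivity)]
    apply le_of_eq; congr 1; ring
  · apply Measurable.aemeasurable
    refine Measurable.smul (f := fun p : ℝ × ℝ => ENNReal.ofReal p.1) (by fun_prop) (hmeas.comp ?_)
    have : (fun p : ℝ × ℝ => Complex.polarCoord.symm p) =
        fun p : ℝ × ℝ => (p.1 : ℂ) * (Real.cos p.2 + Real.sin p.2 * Complex.I) := by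
      ext p; rw [Complex.polarCoord_symm_apply]
    change Measurable (fun p : ℝ × ℝ => Complex.polarCoord.symm p)
    rw [this]
    fun_prop

open MeasureTheory in
lemma kb_area (E : Set ℂ) (hE : MeasurableSet E) (M : ℝ) (hM : ∀ z ∈ E, |z.re| ≤ M)
    (hM0 : 0 ≤ M) (hinj : Set.InjOn Complex.exp E) :
    volume E ≤ ENNReal.ofReal (4 * Real.pi * M) := by
  let p : ℤ → ℂ := fun k => ((2 * Real.pi * k : ℝ) : ℂ) * Complex.I
  let A : ℤ → Set ℂ := fun k => E ∩ {z | ⌊z.im / (2 * Real.pi)⌋ = k}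
  have hA : ∀ k, MeasurableSet (A k) := fun k => hE.inter
    (measurableSet_eq_fun (by fun_prop) measurable_const)
  have hEA : E = ⋃ k, A k := by
    ext z; simp [A]
  have hexp : ∀ k z, Complex.exp (z + p k) = Complex.exp z := by
    intro k z
    rw [Complex.exp_eq_exp_iff_exists_int]
    exact ⟨k, by simp [p]; ring⟩
  have hv : volume E = ∑' k, volume ((fun z => z + p k) ⁻¹' A k) := by
    conv_lhs => rw [hEA]
    rw [measure_iUnion _ hA]
    · simp only [measure_preimage_add_right]
    · intro i j hij
      rw [Function.onFun, Set.disjoint_left]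
      rintro z ⟨_, h1⟩ ⟨_, h2⟩
      exact hij (h1.symm.trans h2)
  rw [hv, ← measure_iUnion]
  · have hsub : (⋃ k, (fun z => z + p k) ⁻¹' A k) ⊆
        Complex.measurableEquivRealProd ⁻¹' (Set.Icc (-M) M ×ˢ Set.Icc 0 (2 * Real.pi)) := by
      intro z hz
      obtain ⟨k, hk, hk2⟩ := Set.mem_iUnion.1 hz
      have h1 := hM _ hk
      simp only [Set.mem_ofPred_eq, Int.floor_eq_iff] at hk2
      have hp := Real.pi_pos
      rw [le_div_iff₀ (by positivity), div_lt_iff₀ (by positivity)] at hk2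
      simp [p] at hk2 h1
      rw [abs_le] at h1
      simp only [Complex.measurableEquivRealProd, Set.mem_preimage, Set.mem_prod, Set.mem_Icc]
      exact ⟨h1, by change 0 ≤ z.im; linarith, by change z.im ≤ _; linarith⟩
    refine (measure_mono hsub).trans (le_of_eq ?_)
    rw [Complex.volume_preserving_equiv_real_prod.measure_preimage
      (measurableSet_Icc.prod measurableSet_Icc).nullMeasurableSet,
      Measure.volume_eq_prod, Measure.prod_prod, Real.volume_Icc, Real.volume_Icc,
      ← ENNReal.ofReal_mul (by linarith)]
    congr 1; ring
  · intro i j hij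
    rw [Function.onFun, Set.disjoint_left]
    rintro z h1 h2
    have h := hinj h1.1 h2.1 (by rw [hexp, hexp])
    apply hij
    have h3 := h1.2
    have h4 := h2.2
    simp only [Set.mem_ofPred_eq] at h3 h4
    simp only at h
    rw [← h3, ← h4, h]
  · intro k
    exact (measurable_add_const _) (hA k)

open MeasureTheory in
lemma kb_A (f : ℂ → ℂ) (hf : DifferentiableOn ℂ f (ball 0 1))
    (hi : Set.InjOn (fun z => Complex.exp (f z)) (ball 0 1)) (s : ℝ) (h0 : 0 < s) (h1 : s < 1)
    (M : ℝ) (hM0 : 0 ≤ M) (hM : ∀ z ∈ ball (0:ℂ) s, |(f z).re| ≤ M) :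
    s ^ 2 * ‖deriv f 0‖ ^ 2 ≤ 4 * M := by
  have hss : ball (0:ℂ) s ⊆ ball 0 1 := ball_subset_ball h1.le
  have hfi : Set.InjOn f (ball 0 s) := by
    intro x hx y hy hxy
    exact hi (hss hx) (hss hy) (by simp [hxy])
  have hder : ∀ z ∈ ball (0:ℂ) s, HasFDerivWithinAt f
      ((ContinuousLinearMap.toSpanSingleton ℂ (deriv f z)).restrictScalars ℝ) (ball 0 s) z := by
    intro z hz
    have := (hf.differentiableAt (isOpen_ball.mem_nhds (hss hz))).hasDerivAt.hasFDerivAt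
    exact (this.restrictScalars ℝ).hasFDerivWithinAt
  have key := lintegral_abs_det_fderiv_eq_addHaar_image volume measurableSet_ball hder hfi
  have hG : DifferentiableOn ℂ (fun z => deriv f z ^ 2) (ball 0 1) :=
    (hf.deriv isOpen_ball).pow 2
  have hd := kb_disc _ hG s h0 h1
  have hm : MeasurableSet (f '' ball 0 s) := measurable_image_of_fderivWithin measurableSet_ball hder hfi
  have ha := kb_area (f '' ball 0 s) hm M (by rintro _ ⟨z, hz, rfl⟩; exact hM z hz) hM0 (by
    rintro _ ⟨z, hz, rfl⟩ _ ⟨w, hw, rfl⟩ h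
    rw [hi (hss hz) (hss hw) h])
  rw [← key] at ha
  have hdet : ∀ z, ENNReal.ofReal |((ContinuousLinearMap.toSpanSingleton ℂ (deriv f z)).restrictScalars ℝ).det| = ‖deriv f z ^ 2‖ₑ := by
    intro z
    have : ((ContinuousLinearMap.toSpanSingleton ℂ (deriv f z)).restrictScalars ℝ).det = ‖deriv f z‖ ^ 2 := by
      simp [ContinuousLinearMap.det, LinearMap.det_restrictScalars,
        Algebra.norm_complex_eq, Complex.normSq_eq_norm_sq]
    rw [this, abs_of_nonneg (by positivity), ← norm_pow, ofReal_norm]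
  simp only [hdet] at ha
  have h := hd.trans ha
  rw [← ofReal_norm, ← ENNReal.ofReal_mul (by positivity),
    ENNReal.ofReal_le_ofReal_iff (by positivity), norm_pow] at h
  have hp := Real.pi_pos
  nlinarith

lemma kb_B (f : ℂ → ℂ) (hf : DifferentiableOn ℂ f (ball 0 1)) (C : ℝ) (hC0 : 0 ≤ C)
    (hC : ∀ z ∈ ball (0:ℂ) 1, ‖deriv f z‖ * (1 - ‖z‖ ^ 2) ≤ C) (z : ℂ) (hz : ‖z‖ < 4 / 5) :
    ‖f z - f 0‖ ≤ C * (5 / 4) := by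
  set R := ‖z‖ with hR
  have hR0 : 0 ≤ R := norm_nonneg z
  have hb : ∀ x ∈ Set.Icc (0:ℝ) 1, x * R < 1 := by
    intro x hx; nlinarith [hx.1, hx.2]
  have hn : ∀ x ∈ Set.Icc (0:ℝ) 1, ‖(x:ℂ) * z‖ = x * R := by
    intro x hx; rw [norm_mul, Complex.norm_real, Real.norm_of_nonneg hx.1]
  have hmem : ∀ x ∈ Set.Icc (0:ℝ) 1, (x:ℂ) * z ∈ ball (0:ℂ) 1 := by
    intro x hx; rw [mem_ball_zero_iff, hn x hx]; exact hb x hx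
  have hder : ∀ x ∈ Set.Icc (0:ℝ) 1,
      HasDerivAt (fun x : ℝ => f (x * z) - f 0) (deriv f (x * z) * z) x := by
    intro x hx
    have h1 := (hf.differentiableAt (isOpen_ball.mem_nhds (hmem x hx))).hasDerivAt
    have h2 : HasDerivAt (fun x : ℝ => (x:ℂ) * z) (1 * z) x :=
      (Complex.ofRealCLM.hasDerivAt (x := x)).mul_const z
    rw [one_mul] at h2
    exact (h1.comp x h2).sub_const _
  have hBd : ∀ x ∈ Set.Icc (0:ℝ) 1,
      HasDerivAt (fun x : ℝ => C / 2 * (Real.log (1 + x * R) - Real.log (1 - x * R)))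
        (C / 2 * (R / (1 + x * R) - (-R) / (1 - x * R))) x := by
    intro x hx
    have hp : 0 ≤ x * R := mul_nonneg hx.1 hR0
    have h1 : HasDerivAt (fun x : ℝ => x * R) R x := by
      simpa using (hasDerivAt_id x).mul_const R
    have h2 := (h1.const_add 1).log (by positivity)
    have h3 := (h1.const_sub 1).log (by linarith [hb x hx])
    exact (h2.sub h3).const_mul _
  have key := image_norm_le_of_norm_deriv_right_le_deriv_boundary' (a := 0) (b := 1)
    (fun x hx => (hder x hx).continuousAt.continuousWithinAt)
    (fun x hx => (hder x ⟨hx.1, hx.2.le⟩).hasDerivWithinAt)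
    (by simp) (fun x hx => (hBd x hx).continuousAt.continuousWithinAt)
    (fun x hx => (hBd x ⟨hx.1, hx.2.le⟩).hasDerivWithinAt)
    (by
      intro x hx
      have hx' : x ∈ Set.Icc (0:ℝ) 1 := ⟨hx.1, hx.2.le⟩
      have h := hC _ (hmem x hx')
      rw [hn x hx'] at h
      have hp : 0 ≤ x * R := mul_nonneg hx.1 hR0
      have hl := hb x hx'
      have h5 : 0 < 1 - (x * R) ^ 2 := by nlinarith
      rw [← le_div_iff₀ h5] at h
      rw [norm_mul]
      calc _ ≤ C / (1 - (x * R) ^ 2) * R := by gcongr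
        _ = _ := by
          have h6 : 1 - x * R ≠ 0 := by linarith
          have h7 : 1 + x * R ≠ 0 := by positivity
          rw [show 1 - (x * R) ^ 2 = (1 - x * R) * (1 + x * R) by ring]
          field_simp
          ring)
    (Set.right_mem_Icc.2 zero_le_one)
  simp only [Complex.ofReal_one, one_mul] at key
  refine key.trans ?_
  have h9 : Real.log (1 + R) - Real.log (1 - R) ≤ 5 / 2 := by
    have : Real.log (1 + R) ≤ Real.log (9 * (1 - R)) :=
      Real.log_le_log (by linarith) (by linarith)
    rw [Real.log_mul (by norm_num) (by linarith)] at this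
    have h3 : Real.log 9 = 2 * (Real.log 2 + Real.log (3 / 2)) := by
      rw [← Real.log_mul (by norm_num) (by norm_num)]
      rw [show (9:ℝ) = (2 * (3 / 2)) ^ 2 by norm_num, Real.log_pow]; norm_num
    have h4 := Real.log_two_lt_d9
    have h5 := Real.log_le_sub_one_of_pos (show (0:ℝ) < 3 / 2 by norm_num)
    linarith
  nlinarith

lemma kb_extremal (f : ℂ → ℂ) (hf : DifferentiableOn ℂ f (ball 0 1))
    (hi : Set.InjOn (fun z => Complex.exp (f z)) (ball 0 1)) (C : ℝ) (hC0 : 0 < C)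
    (hC : ∀ z ∈ ball (0:ℂ) 1, ‖deriv f z‖ * (1 - ‖z‖ ^ 2) ≤ C) (heq : ‖deriv f 0‖ = C) :
    C ≤ 125 / 16 := by
  have hA := kb_A (fun z => f z - f 0) (hf.sub_const _) (by
    intro x hx y hy h
    simp only [Complex.exp_sub] at h
    exact hi hx hy (by simpa using h)) (4 / 5) (by norm_num) (by norm_num) (C * (5 / 4))
    (by positivity) (fun z hz => (Complex.abs_re_le_norm _).trans
      (kb_B f hf C hC0.le hC z (by simpa using hz)))
  rw [deriv_sub_const, heq] at hA
  nlinarith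

lemma kb_mob_id (a z : ℂ) : ‖1 + star a * z‖ ^ 2 - ‖z + a‖ ^ 2 = (1 - ‖a‖ ^ 2) * (1 - ‖z‖ ^ 2) := by
  simp only [← Complex.normSq_eq_norm_sq, Complex.normSq_apply]
  simp
  ring

lemma kb_mob (f : ℂ → ℂ) (hf : DifferentiableOn ℂ f (ball 0 1))
    (hi : Set.InjOn (fun z => Complex.exp (f z)) (ball 0 1)) (a : ℂ) (ha : ‖a‖ < 1)
    (hmax : ∀ z ∈ ball (0:ℂ) 1, ‖deriv f z‖ * (1 - ‖z‖ ^ 2) ≤ ‖deriv f a‖ * (1 - ‖a‖ ^ 2)) :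
    ‖deriv f a‖ * (1 - ‖a‖ ^ 2) ≤ 125 / 16 := by
  rcases le_or_gt (‖deriv f a‖ * (1 - ‖a‖ ^ 2)) 0 with h | hpos
  · linarith
  have ha2 : 0 < 1 - ‖a‖ ^ 2 := by nlinarith [norm_nonneg a]
  have hden : ∀ z ∈ ball (0:ℂ) 1, 1 + star a * z ≠ 0 := by
    intro z hz h
    rw [mem_ball_zero_iff] at hz
    have h1 := kb_mob_id a z
    rw [h, norm_zero] at h1
    have : 0 < 1 - ‖z‖ ^ 2 := by nlinarith [norm_nonneg z]
    have := mul_pos ha2 this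
    nlinarith [sq_nonneg ‖z + a‖]
  let m : ℂ → ℂ := fun z => (z + a) / (1 + star a * z)
  have hm1 : ∀ z ∈ ball (0:ℂ) 1, 1 - ‖m z‖ ^ 2 =
      (1 - ‖a‖ ^ 2) * (1 - ‖z‖ ^ 2) / ‖1 + star a * z‖ ^ 2 := by
    intro z hz
    have h0 : ‖1 + star a * z‖ ≠ 0 := norm_ne_zero_iff.2 (hden z hz)
    rw [← kb_mob_id, norm_div, div_pow, sub_div, div_self (pow_ne_zero 2 h0)]
  have hmb : ∀ z ∈ ball (0:ℂ) 1, m z ∈ ball (0:ℂ) 1 := by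
    intro z hz
    have h1 := hm1 z hz
    have hz' := hz
    rw [mem_ball_zero_iff] at hz' ⊢
    have h2 : 0 < 1 - ‖z‖ ^ 2 := by nlinarith [norm_nonneg z]
    have h0 : 0 < ‖1 + star a * z‖ := norm_pos_iff.2 (hden z hz)
    have : 0 < 1 - ‖m z‖ ^ 2 := by rw [h1]; positivity
    nlinarith [norm_nonneg (m z)]
  have hnorm : (a * star a) = ((‖a‖ ^ 2 : ℝ) : ℂ) := by
    have := Complex.mul_conj a
    rw [Complex.normSq_eq_norm_sq] at this
    exact this
  have hmd : ∀ z ∈ ball (0:ℂ) 1,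
      HasDerivAt m (((1 - ‖a‖ ^ 2 : ℝ) : ℂ) / (1 + star a * z) ^ 2) z := by
    intro z hz
    have h1 : HasDerivAt (fun z : ℂ => z + a) 1 z := (hasDerivAt_id z).add_const a
    have h2 : HasDerivAt (fun z : ℂ => 1 + star a * z) (star a) z := by
      simpa using ((hasDerivAt_id z).const_mul (star a)).const_add 1
    have h3 := h1.div h2 (hden z hz)
    refine h3.congr_deriv ?_
    congr 1
    push_cast at hnorm ⊢
    linear_combination -hnorm
  have hFd : ∀ z ∈ ball (0:ℂ) 1, HasDerivAt (fun z => f (m z))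
      (deriv f (m z) * (((1 - ‖a‖ ^ 2 : ℝ) : ℂ) / (1 + star a * z) ^ 2)) z := fun z hz =>
    (hf.differentiableAt (isOpen_ball.mem_nhds (hmb z hz))).hasDerivAt.comp z (hmd z hz)
  have hm0 : m 0 = a := by simp [m]
  apply kb_extremal (fun z => f (m z))
  · exact fun z hz => (hFd z hz).differentiableAt.differentiableWithinAt
  · intro x hx y hy h
    have h1 : m x = m y := hi (hmb x hx) (hmb y hy) h
    simp only [m] at h1
    rw [div_eq_div_iff (hden x hx) (hden y hy)] at h1
    have h2 : (x - y) * ((1 - ‖a‖ ^ 2 : ℝ) : ℂ) = 0 := by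
      push_cast at hnorm ⊢
      linear_combination h1 + (x - y) * hnorm
    rcases mul_eq_zero.1 h2 with h3 | h3
    · exact sub_eq_zero.1 h3
    · exact absurd (Complex.ofReal_eq_zero.1 h3) ha2.ne'
  · exact hpos
  · intro z hz
    refine le_trans (le_of_eq ?_) (hmax (m z) (hmb z hz))
    rw [hm1 z hz, (hFd z hz).deriv, norm_mul, norm_div, norm_pow, Complex.norm_real,
      Real.norm_of_nonneg ha2.le]
    ring
  · rw [(hFd 0 (by simp)).deriv, hm0, norm_mul]
    simp only [mul_zero, add_zero, one_pow, div_one, Complex.norm_real]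
    rw [Real.norm_of_nonneg ha2.le]

lemma kb_bound (f : ℂ → ℂ) (hf : DifferentiableOn ℂ f (ball 0 1))
    (hi : Set.InjOn (fun z => Complex.exp (f z)) (ball 0 1)) (z : ℂ) (hz : ‖z‖ ≤ 1 / 16) :
    ‖deriv f z‖ ≤ 8 := by
  set t : ℝ := 99 / 100 with ht
  let g : ℂ → ℂ := fun z => f (t * z)
  have hn : ∀ z : ℂ, ‖(t:ℂ) * z‖ = t * ‖z‖ := by
    intro z; rw [norm_mul, Complex.norm_real, Real.norm_of_nonneg (by norm_num [ht])]
  have hmem : ∀ z ∈ closedBall (0:ℂ) 1, (t:ℂ) * z ∈ ball (0:ℂ) 1 := by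
    intro z hz
    rw [mem_closedBall_zero_iff] at hz
    rw [mem_ball_zero_iff, hn]
    rw [ht]; linarith
  have hgd : ∀ z ∈ closedBall (0:ℂ) 1, HasDerivAt g (deriv f (t * z) * t) z := by
    intro z hz
    have h2 : HasDerivAt (fun z : ℂ => (t:ℂ) * z) t z := by
      simpa using (hasDerivAt_id z).const_mul (t:ℂ)
    exact (hf.differentiableAt (isOpen_ball.mem_nhds (hmem z hz))).hasDerivAt.comp z h2
  have hcont : ContinuousOn (fun z => ‖deriv f (t * z) * t‖ * (1 - ‖z‖ ^ 2)) (closedBall (0:ℂ) 1) := by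
    have : ContinuousOn (fun z : ℂ => deriv f (t * z)) (closedBall (0:ℂ) 1) :=
      (hf.deriv isOpen_ball).continuousOn.comp (by fun_prop) hmem
    fun_prop
  obtain ⟨a, ha, hmax⟩ := (isCompact_closedBall (0:ℂ) 1).exists_isMaxOn ⟨0, by simp⟩ hcont
  have hmax' : ∀ z ∈ closedBall (0:ℂ) 1, ‖deriv g z‖ * (1 - ‖z‖ ^ 2) ≤ ‖deriv g a‖ * (1 - ‖a‖ ^ 2) := by
    intro z hz
    rw [(hgd z hz).deriv, (hgd a ha).deriv]
    exact hmax hz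
  have hC : ‖deriv g a‖ * (1 - ‖a‖ ^ 2) ≤ 125 / 16 := by
    rcases eq_or_lt_of_le (mem_closedBall_zero_iff.1 ha) with h | h
    · rw [h]; norm_num
    · apply kb_mob g
      · exact fun z hz => (hgd z (ball_subset_closedBall hz)).differentiableAt.differentiableWithinAt
      · intro x hx y hy hxy
        have := hi (hmem x (ball_subset_closedBall hx)) (hmem y (ball_subset_closedBall hy)) hxy
        exact mul_left_cancel₀ (by norm_num [ht]) this
      · exact h
      · exact fun z hz => hmax' z (ball_subset_closedBall hz)
  have hw : (t:ℂ) * (z / t) = z := by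
    field_simp [show (t:ℂ) ≠ 0 by norm_num [ht]]
  have hwn : ‖z / t‖ = ‖z‖ / t := by
    rw [norm_div, Complex.norm_real, Real.norm_of_nonneg (by norm_num [ht])]
  have hwle : ‖z / t‖ ≤ 1 / 15 := by
    rw [hwn, ht]; linarith
  have hwm : z / t ∈ closedBall (0:ℂ) 1 := by rw [mem_closedBall_zero_iff]; linarith
  have h := (hmax' _ hwm).trans hC
  rw [(hgd _ hwm).deriv, hw, norm_mul, Complex.norm_real, Real.norm_of_nonneg (by norm_num [ht])] at h
  have h3 : 1 - 1 / 225 ≤ 1 - ‖z / t‖ ^ 2 := by nlinarith [norm_nonneg (z / t)]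
  have h4 : ‖deriv f z‖ * t * (1 - 1 / 225) ≤ 125 / 16 :=
    (mul_le_mul_of_nonneg_left h3 (by rw [ht]; positivity)).trans h
  rw [ht] at h4
  linarith

lemma kb_log (g : ℂ → ℂ) (hg : DifferentiableOn ℂ g (ball 0 1)) (h0 : ∀ z ∈ ball (0:ℂ) 1, g z ≠ 0) :
    ∃ f : ℂ → ℂ, DifferentiableOn ℂ f (ball 0 1) ∧ ∀ z ∈ ball (0:ℂ) 1, Complex.exp (f z) = g z := by
  have hd : DifferentiableOn ℂ (fun z => deriv g z / g z) (ball 0 1) :=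
    (hg.deriv isOpen_ball).div hg h0
  obtain ⟨f, hf0, hf⟩ := hd.isExactOn_ball.with_val_at 0 (Complex.log (g 0))
  refine ⟨f, fun z hz => (hf z hz).differentiableAt.differentiableWithinAt, fun z hz => ?_⟩
  have hk : ∀ z ∈ ball (0:ℂ) 1, HasDerivAt (fun z => Complex.exp (-f z) * g z) 0 z := by
    intro z hz
    have h1 := ((hf z hz).neg.cexp).mul (hg.differentiableAt (isOpen_ball.mem_nhds hz)).hasDerivAt
    refine h1.congr_deriv ?_
    have := h0 z hz
    field_simp
    ring
  have hconst := (convex_ball (0:ℂ) 1).is_const_of_fderivWithin_eq_zero (𝕜 := ℂ)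
    (f := fun z => Complex.exp (-f z) * g z)
    (fun z hz => (hk z hz).differentiableAt.differentiableWithinAt)
    (fun z hz => by
      have h := (hk z hz).hasFDerivAt.hasFDerivWithinAt (s := ball (0:ℂ) 1)
      rw [h.fderivWithin (isOpen_ball.uniqueDiffWithinAt hz)]
      ext; simp) hz (mem_ball_self one_pos)
  simp only [hf0, Complex.exp_neg] at hconst
  rw [Complex.exp_log (h0 0 (by simp)), inv_mul_cancel₀ (h0 0 (by simp)),
    inv_mul_eq_one₀ (Complex.exp_ne_zero _)] at hconst
  exact hconst

/-- Inequality (p3) inside Lemma A.8 (lem:conf): for `r ∈ (0, 1/16]`, a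
normalized conformal embedding `φ` of the unit disk (injective, holomorphic,
`φ(0) = 0`) and a point `z` with `|z| ≤ r`, one has
`dist(φ(z), ℂ \ φ(𝔻)) ≥ (1 − 8r)·dist(0, ℂ \ φ(𝔻))`. -/
theorem stmt_17 (r : ℝ) (hr0 : 0 < r) (hr1 : r ≤ 1 / 16)
    (φ : ℂ → ℂ) (hφd : DifferentiableOn ℂ φ (ball 0 1))
    (hφi : Set.InjOn φ (ball 0 1)) (hφ0 : φ 0 = 0)
    (z : ℂ) (hz : ‖z‖ ≤ r) :
    (1 - 8 * r) * infDist 0 (φ '' ball 0 1)ᶜ ≤ infDist (φ z) (φ '' ball 0 1)ᶜ := by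
  rcases Set.eq_empty_or_nonempty (φ '' ball 0 1)ᶜ with he | hne
  · rw [he]; simp
  rw [le_infDist hne]
  intro w hw
  obtain ⟨f, hf, hfe⟩ := kb_log (fun z => φ z - w) (hφd.sub_const w) (by
    intro z hz h
    exact hw ⟨z, hz, sub_eq_zero.1 h⟩)
  have hi : Set.InjOn (fun z => Complex.exp (f z)) (ball 0 1) := by
    intro x hx y hy h
    simp only [hfe x hx, hfe y hy] at h
    exact hφi hx hy (sub_left_inj.1 h)
  have hsub : closedBall (0:ℂ) (1 / 16) ⊆ ball 0 1 := closedBall_subset_ball (by norm_num)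
  have hz16 : z ∈ closedBall (0:ℂ) (1 / 16) := by
    rw [mem_closedBall_zero_iff]; linarith
  have hmv := (convex_closedBall (0:ℂ) (1 / 16)).norm_image_sub_le_of_norm_deriv_le (f := f) (C := 8)
    (fun x hx => hf.differentiableAt (isOpen_ball.mem_nhds (hsub hx)))
    (fun x hx => kb_bound f hf hi x (mem_closedBall_zero_iff.1 hx))
    (mem_closedBall_self (by norm_num)) hz16
  rw [sub_zero] at hmv
  have hre := (abs_le.1 ((Complex.abs_re_le_norm (f z - f 0)).trans hmv)).1
  rw [Complex.sub_re] at hre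
  have e1 : ‖φ z - w‖ = Real.exp (f z).re := by rw [← hfe z (hsub hz16), Complex.norm_exp]
  have e0 : ‖w‖ = Real.exp (f 0).re := by
    rw [← Complex.norm_exp, hfe 0 (by simp), hφ0, zero_sub, norm_neg]
  have hd0 : infDist 0 (φ '' ball 0 1)ᶜ ≤ ‖w‖ := by
    have := infDist_le_dist_of_mem (x := 0) hw
    rwa [dist_zero_left] at this
  rw [dist_eq_norm, e1]
  calc (1 - 8 * r) * infDist 0 (φ '' ball 0 1)ᶜ ≤ Real.exp (-(8 * r)) * ‖w‖ := by
        gcongr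
        · exact infDist_nonneg
        · linarith [Real.add_one_le_exp (-(8 * r))]
    _ = Real.exp (-(8 * r) + (f 0).re) := by rw [e0, Real.exp_add]
    _ ≤ _ := Real.exp_le_exp.2 (by linarith)
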